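/- Fix τ ∈ (−1,1) with τ ≠ 0. If p : [0,1]² → ℝ is a twice continuously differentiable copula density (p > 0, uniform marginals) that minimizes the Shannon information ∫₀¹∫₀¹ p log p over copula densities with Kendall's τ functional equal to τ, then p is the Frank copula density c_θ with the parameter θ ≠ 0 determined by the Debye-function relation τ = 1 − (4/θ)[1 − (1/θ)∫₀^θ t/(e^t − 1) dt]. -/

import Mathlib

/-- The Frank copula density with parameter `θ ≠ 0`. -/
noncomputable def frankDensity (θ u v : ℝ) : ℝ :=
  θ * (1 - Real.exp (-θ)) * Real.exp (-θ * (u + v)) /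
    (1 - Real.exp (-θ) - (1 - Real.exp (-θ * u)) * (1 - Real.exp (-θ * v))) ^ 2

/-- A bivariate copula density: twice continuously differentiable on `[0,1]²`,
positive, with uniform marginals. -/
structure IsCopulaDensity (p : ℝ → ℝ → ℝ) : Prop where
  smooth : ContDiffOn ℝ 2 (Function.uncurry p) (Set.Icc 0 1 ×ˢ Set.Icc 0 1)
  pos : ∀ u ∈ Set.Icc (0 : ℝ) 1, ∀ v ∈ Set.Icc (0 : ℝ) 1, 0 < p u v
  margU : ∀ v ∈ Set.Icc (0 : ℝ) 1, (∫ u in (0 : ℝ)..1, p u v) = 1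
  margV : ∀ u ∈ Set.Icc (0 : ℝ) 1, (∫ v in (0 : ℝ)..1, p u v) = 1

/-- The Kendall's τ functional of a bivariate density on the unit square. -/
noncomputable def kendallTau (p : ℝ → ℝ → ℝ) : ℝ :=
  ∫ u in (0 : ℝ)..1, ∫ v in (0 : ℝ)..1, ∫ u' in (0 : ℝ)..1, ∫ v' in (0 : ℝ)..1,
    Real.sign (u - u') * Real.sign (v - v') * p u v * p u' v'

/-- The Shannon information (negative entropy) of a bivariate density. -/
noncomputable def shannonInfo (p : ℝ → ℝ → ℝ) : ℝ :=
  ∫ u in (0 : ℝ)..1, ∫ v in (0 : ℝ)..1, p u v * Real.log (p u v)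

open MeasureTheory Set Filter Topology
open scoped ContDiff

/-! ### Integrals of continuous functions over the unit square -/

theorem continuous_intervalIntegral_right (F : C(ℝ × ℝ, ℝ)) (a b : ℝ) :
    Continuous fun u => ∫ v in a..b, F (u, v) :=
  intervalIntegral.continuous_parametric_intervalIntegral_of_continuous'
    (f := fun u v => F (u, v)) F.continuous a b

/-- Integration over the unit square, as a linear form on continuous functions. -/
noncomputable def squareIntegral : C(ℝ × ℝ, ℝ) →ₗ[ℝ] ℝ where
  toFun F := ∫ u in (0 : ℝ)..1, ∫ v in (0 : ℝ)..1, F (u, v)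
  map_add' F G := by
    have (u : ℝ) : ∫ v in (0 : ℝ)..1, (F + G) (u, v) =
        (∫ v in (0 : ℝ)..1, F (u, v)) + ∫ v in (0 : ℝ)..1, G (u, v) := by
      simp only [ContinuousMap.add_apply]
      exact intervalIntegral.integral_add
        (Continuous.intervalIntegrable (by fun_prop) _ _)
        (Continuous.intervalIntegrable (by fun_prop) _ _)
    simp only [this]
    exact intervalIntegral.integral_add
      ((continuous_intervalIntegral_right F 0 1).intervalIntegrable _ _)
      ((continuous_intervalIntegral_right G 0 1).intervalIntegrable _ _)
  map_smul' c F := by simp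

theorem squareIntegral_apply (F : C(ℝ × ℝ, ℝ)) :
    squareIntegral F = ∫ u in (0 : ℝ)..1, ∫ v in (0 : ℝ)..1, F (u, v) := rfl

theorem integral_integral_comm (F : C(ℝ × ℝ, ℝ)) (a b c d : ℝ) :
    ∫ u in a..b, ∫ v in c..d, F (u, v) = ∫ v in c..d, ∫ u in a..b, F (u, v) :=
  intervalIntegral_intervalIntegral_swap (F := fun u v => F (u, v))
    ((F.continuous.continuousOn.integrableOn_compact (isCompact_uIcc.prod isCompact_uIcc)).mono_set
      (prod_mono uIoc_subset_uIcc uIoc_subset_uIcc))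

theorem squareIntegral_swap (F : C(ℝ × ℝ, ℝ)) :
    squareIntegral F = ∫ v in (0 : ℝ)..1, ∫ u in (0 : ℝ)..1, F (u, v) :=
  integral_integral_comm F 0 1 0 1

theorem integral_zero_one_congr {f g : ℝ → ℝ} (h : ∀ x ∈ Icc (0 : ℝ) 1, f x = g x) :
    ∫ x in (0 : ℝ)..1, f x = ∫ x in (0 : ℝ)..1, g x := by
  refine intervalIntegral.integral_congr fun x hx => h x ?_
  rwa [uIcc_of_le zero_le_one] at hx

theorem squareIntegral_congr {F G : C(ℝ × ℝ, ℝ)}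
    (h : ∀ u ∈ Icc (0 : ℝ) 1, ∀ v ∈ Icc (0 : ℝ) 1, F (u, v) = G (u, v)) :
    squareIntegral F = squareIntegral G :=
  integral_zero_one_congr fun u hu => integral_zero_one_congr fun v hv => h u hu v hv

theorem squareIntegral_mono {F G : C(ℝ × ℝ, ℝ)}
    (h : ∀ u ∈ Icc (0 : ℝ) 1, ∀ v ∈ Icc (0 : ℝ) 1, F (u, v) ≤ G (u, v)) :
    squareIntegral F ≤ squareIntegral G := by
  refine intervalIntegral.integral_mono_on zero_le_one
    ((continuous_intervalIntegral_right F 0 1).intervalIntegrable _ _)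
    ((continuous_intervalIntegral_right G 0 1).intervalIntegrable _ _) fun u hu => ?_
  exact intervalIntegral.integral_mono_on zero_le_one
    (Continuous.intervalIntegrable (by fun_prop) _ _)
    (Continuous.intervalIntegrable (by fun_prop) _ _) fun v hv => h u hu v hv

/-- The product `(u, v) ↦ f u * g v`. -/
def tensor (f g : C(ℝ, ℝ)) : C(ℝ × ℝ, ℝ) := ⟨fun z => f z.1 * g z.2, by fun_prop⟩

@[simp] theorem tensor_apply (f g : C(ℝ, ℝ)) (z : ℝ × ℝ) : tensor f g z = f z.1 * g z.2 := rfl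

theorem squareIntegral_tensor (f g : C(ℝ, ℝ)) :
    squareIntegral (tensor f g) = (∫ u in (0 : ℝ)..1, f u) * ∫ v in (0 : ℝ)..1, g v := by
  simp [squareIntegral_apply]

/-- The primitive of `f` vanishing at `0`. -/
noncomputable def primitive (f : C(ℝ, ℝ)) : C(ℝ, ℝ) :=
  ⟨fun x => ∫ t in (0 : ℝ)..x, f t,
    intervalIntegral.continuous_primitive (fun _ _ => f.continuous.intervalIntegrable _ _) 0⟩

theorem primitive_apply (f : C(ℝ, ℝ)) (x : ℝ) : primitive f x = ∫ t in (0 : ℝ)..x, f t := rfl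

theorem hasDerivAt_primitive (f : C(ℝ, ℝ)) (x : ℝ) : HasDerivAt (primitive f) (f x) x :=
  intervalIntegral.integral_hasDerivAt_right (f.continuous.intervalIntegrable _ _)
    (f.continuous.stronglyMeasurableAtFilter _ _) f.continuous.continuousAt

/-- The partial distribution function `(u, v) ↦ ∫₀ᵛ F(u, t) dt`. -/
noncomputable def partialCumulative (F : C(ℝ × ℝ, ℝ)) : C(ℝ × ℝ, ℝ) :=
  ⟨fun z => ∫ t in (0 : ℝ)..z.2, F (z.1, t),
    intervalIntegral.continuous_parametric_intervalIntegral_of_continuous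
      (f := fun (z : ℝ × ℝ) t => F (z.1, t)) (by fun_prop) continuous_snd⟩

theorem partialCumulative_apply (F : C(ℝ × ℝ, ℝ)) (u v : ℝ) :
    partialCumulative F (u, v) = ∫ t in (0 : ℝ)..v, F (u, t) := rfl

theorem hasDerivAt_partialCumulative (F : C(ℝ × ℝ, ℝ)) (u v : ℝ) :
    HasDerivAt (fun t => partialCumulative F (u, t)) (F (u, v)) v :=
  hasDerivAt_primitive ⟨fun t => F (u, t), by fun_prop⟩ v

/-- The distribution function `(u, v) ↦ ∫₀ᵘ ∫₀ᵛ F(s, t) dt ds`. -/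
noncomputable def cumulative (F : C(ℝ × ℝ, ℝ)) : C(ℝ × ℝ, ℝ) :=
  ⟨fun z => ∫ s in (0 : ℝ)..z.1, partialCumulative F (s, z.2),
    intervalIntegral.continuous_parametric_intervalIntegral_of_continuous
      (f := fun (z : ℝ × ℝ) s => partialCumulative F (s, z.2)) (by fun_prop) continuous_fst⟩

theorem cumulative_apply (F : C(ℝ × ℝ, ℝ)) (u v : ℝ) :
    cumulative F (u, v) = ∫ s in (0 : ℝ)..u, partialCumulative F (s, v) := rfl

theorem hasDerivAt_cumulative (F : C(ℝ × ℝ, ℝ)) (u v : ℝ) :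
    HasDerivAt (fun s => cumulative F (s, v)) (partialCumulative F (u, v)) u :=
  hasDerivAt_primitive ⟨fun s => partialCumulative F (s, v), by fun_prop⟩ u

@[simp] theorem partialCumulative_right_zero (F : C(ℝ × ℝ, ℝ)) (u : ℝ) :
    partialCumulative F (u, 0) = 0 := by simp [partialCumulative_apply]

@[simp] theorem cumulative_left_zero (F : C(ℝ × ℝ, ℝ)) (v : ℝ) : cumulative F (0, v) = 0 := by
  simp [cumulative_apply]

@[simp] theorem cumulative_right_zero (F : C(ℝ × ℝ, ℝ)) (u : ℝ) : cumulative F (u, 0) = 0 := by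
  simp [cumulative_apply]

theorem partialCumulative_add (F G : C(ℝ × ℝ, ℝ)) :
    partialCumulative (F + G) = partialCumulative F + partialCumulative G := by
  ext ⟨u, v⟩
  simp only [partialCumulative_apply, ContinuousMap.add_apply]
  exact intervalIntegral.integral_add
    (Continuous.intervalIntegrable (by fun_prop) _ _)
    (Continuous.intervalIntegrable (by fun_prop) _ _)

theorem cumulative_add (F G : C(ℝ × ℝ, ℝ)) :
    cumulative (F + G) = cumulative F + cumulative G := by
  ext ⟨u, v⟩
  simp only [cumulative_apply, partialCumulative_add, ContinuousMap.add_apply]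
  exact intervalIntegral.integral_add
    (Continuous.intervalIntegrable (by fun_prop) _ _)
    (Continuous.intervalIntegrable (by fun_prop) _ _)

theorem cumulative_smul_tensor (c : ℝ) (f g : C(ℝ, ℝ)) :
    cumulative (c • tensor f g) = c • tensor (primitive f) (primitive g) := by
  ext ⟨u, v⟩
  simp [cumulative_apply, partialCumulative_apply, primitive_apply]

theorem integral_mul_primitive (f : C(ℝ, ℝ)) (hf : ∫ x in (0 : ℝ)..1, f x = 0) :
    ∫ x in (0 : ℝ)..1, f x * primitive f x = 0 := by
  have h : ∀ x ∈ uIcc (0 : ℝ) 1,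
      HasDerivAt (fun x => primitive f x ^ 2 / 2) (f x * primitive f x) x := fun x _ => by
    refine (((hasDerivAt_primitive f x).pow 2).div_const 2).congr_deriv ?_
    simp; ring
  rw [intervalIntegral.integral_eq_sub_of_hasDerivAt h
    (Continuous.intervalIntegrable (by fun_prop) _ _)]
  simp [primitive_apply, hf]

/-- Integrating by parts in each variable moves the primitives onto the density. -/
theorem squareIntegral_mul_tensor_primitive (F : C(ℝ × ℝ, ℝ)) (f g : C(ℝ, ℝ))
    (hf : ∫ x in (0 : ℝ)..1, f x = 0) (hg : ∫ x in (0 : ℝ)..1, g x = 0) :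
    squareIntegral (F * tensor (primitive f) (primitive g)) =
      squareIntegral (tensor f g * cumulative F) := by
  have h0 (k : C(ℝ, ℝ)) : primitive k 0 = 0 := by simp [primitive_apply]
  have hf1 : primitive f 1 = 0 := hf
  have hg1 : primitive g 1 = 0 := hg
  have inner (u : ℝ) : ∫ v in (0 : ℝ)..1, primitive g v * F (u, v) =
      -∫ v in (0 : ℝ)..1, g v * partialCumulative F (u, v) := by
    rw [intervalIntegral.integral_mul_deriv_eq_deriv_mul
      (fun v _ => hasDerivAt_primitive g v) (fun v _ => hasDerivAt_partialCumulative F u v)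
      (g.continuous.intervalIntegrable _ _) (Continuous.intervalIntegrable (by fun_prop) _ _)]
    simp [hg1]
  have outer (v : ℝ) : ∫ u in (0 : ℝ)..1, primitive f u * partialCumulative F (u, v) =
      -∫ u in (0 : ℝ)..1, f u * cumulative F (u, v) := by
    rw [intervalIntegral.integral_mul_deriv_eq_deriv_mul
      (fun u _ => hasDerivAt_primitive f u) (fun u _ => hasDerivAt_cumulative F u v)
      (f.continuous.intervalIntegrable _ _) (Continuous.intervalIntegrable (by fun_prop) _ _)]
    simp [hf1]
  calc squareIntegral (F * tensor (primitive f) (primitive g))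
      = ∫ u in (0 : ℝ)..1, primitive f u * ∫ v in (0 : ℝ)..1, primitive g v * F (u, v) := by
        simp only [squareIntegral_apply, ← intervalIntegral.integral_const_mul]
        congr! 4; simp; ring
    _ = squareIntegral (-(tensor (primitive f) g * partialCumulative F)) := by
        simp only [inner, squareIntegral_apply, ← intervalIntegral.integral_neg,
          ← intervalIntegral.integral_const_mul]
        congr! 4; simp; ring
    _ = ∫ v in (0 : ℝ)..1,
          -(g v * ∫ u in (0 : ℝ)..1, primitive f u * partialCumulative F (u, v)) := by
        simp only [squareIntegral_swap, ← intervalIntegral.integral_neg,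
          ← intervalIntegral.integral_const_mul]
        congr! 4; simp; ring
    _ = squareIntegral (tensor f g * cumulative F) := by
        simp only [outer, squareIntegral_swap, ← intervalIntegral.integral_neg,
          ← intervalIntegral.integral_const_mul]
        congr! 4; simp; ring

/-! ### A du Bois-Reymond lemma for additively separable functions -/

theorem eq_of_integral_mul_eq_zero {M : ℝ → ℝ} (hM : Continuous M)
    (h : ∀ f : C(ℝ, ℝ), ContDiff ℝ ∞ f → ∫ x in (0 : ℝ)..1, f x = 0 →
      ∫ x in (0 : ℝ)..1, f x * M x = 0) {u : ℝ} (hu : u ∈ Icc (0 : ℝ) 1) : M u = M 0 := by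
  set m := ∫ x in (0 : ℝ)..1, M x with hm
  have key : ∀ᵐ x, x ∈ Ioo (0 : ℝ) 1 → M x - m = 0 := by
    refine isOpen_Ioo.ae_eq_zero_of_integral_contDiff_smul_eq_zero
      ((hM.sub continuous_const).locallyIntegrable.locallyIntegrableOn _) fun g hg _ hsupp => ?_
    have hgc : Continuous g := hg.continuous
    have e : ∫ x, g x • (M x - m) = ∫ x in (0 : ℝ)..1, g x * (M x - m) := by
      rw [intervalIntegral.integral_of_le zero_le_one, integral_Ioc_eq_integral_Ioo]
      refine (setIntegral_eq_integral_of_forall_compl_eq_zero fun x hx => ?_).symm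
      have : g x = 0 := by
        by_contra hne
        exact hx (hsupp (subset_tsupport g hne))
      simp [this]
    set c := ∫ x in (0 : ℝ)..1, g x with hc
    have h1 := h ⟨fun x => g x - c, by fun_prop⟩ (hg.sub contDiff_const) (by
      simp only [ContinuousMap.coe_mk]
      rw [intervalIntegral.integral_sub (hgc.intervalIntegrable _ _) (by simp)]
      simp [hc])
    simp only [ContinuousMap.coe_mk] at h1
    rw [e]
    have h2 : ∫ x in (0 : ℝ)..1, g x * (M x - m) =
        (∫ x in (0 : ℝ)..1, (g x - c) * M x) + c * (∫ x in (0 : ℝ)..1, M x)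
          - m * ∫ x in (0 : ℝ)..1, g x := by
      rw [← intervalIntegral.integral_const_mul, ← intervalIntegral.integral_const_mul,
        ← intervalIntegral.integral_add (Continuous.intervalIntegrable (by fun_prop) _ _)
          (Continuous.intervalIntegrable (by fun_prop) _ _),
        ← intervalIntegral.integral_sub (Continuous.intervalIntegrable (by fun_prop) _ _)
          (Continuous.intervalIntegrable (by fun_prop) _ _)]
      congr! 2; ring
    rw [h2, h1, ← hm, ← hc]; ring
  have h3 : EqOn M (fun _ => m) (Icc 0 1) := by
    refine Measure.eqOn_Icc_of_ae_eq volume zero_ne_one ?_ hM.continuousOn continuousOn_const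
    rw [← Measure.restrict_congr_set Ioo_ae_eq_Icc]
    refine (ae_restrict_iff' measurableSet_Ioo).2 (key.mono fun x hx hx' => ?_)
    linarith [hx hx']
  rw [h3 hu, h3 (left_mem_Icc.2 zero_le_one)]

theorem separable_of_squareIntegral_eq_zero (L : C(ℝ × ℝ, ℝ))
    (h : ∀ f g : C(ℝ, ℝ), ContDiff ℝ ∞ f → ContDiff ℝ ∞ g → ∫ x in (0 : ℝ)..1, f x = 0 →
      ∫ x in (0 : ℝ)..1, g x = 0 → squareIntegral (tensor f g * L) = 0)
    {u v : ℝ} (hu : u ∈ Icc (0 : ℝ) 1) (hv : v ∈ Icc (0 : ℝ) 1) :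
    L (u, v) = L (u, 0) + L (0, v) - L (0, 0) := by
  have step (g : C(ℝ, ℝ)) (hg : ContDiff ℝ ∞ g) (hg0 : ∫ x in (0 : ℝ)..1, g x = 0) :
      ∫ v in (0 : ℝ)..1, g v * L (u, v) = ∫ v in (0 : ℝ)..1, g v * L (0, v) := by
    refine eq_of_integral_mul_eq_zero (M := fun u => ∫ v in (0 : ℝ)..1, g v * L (u, v))
      (continuous_intervalIntegral_right ⟨fun z => g z.2 * L z, by fun_prop⟩ 0 1)
      (fun f hf hf0 => ?_) hu
    refine Eq.trans ?_ (h f g hf hg hf0 hg0)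
    simp only [squareIntegral_apply, ← intervalIntegral.integral_const_mul]
    congr! 4; simp; ring
  have := eq_of_integral_mul_eq_zero (M := fun v => L (u, v) - L (0, v)) (by fun_prop)
    (fun g hg hg0 => by
      simp only [mul_sub]
      rw [intervalIntegral.integral_sub (Continuous.intervalIntegrable (by fun_prop) _ _)
        (Continuous.intervalIntegrable (by fun_prop) _ _), step g hg hg0, sub_self]) hv
  linarith

/-! ### Kendall's functional through the distribution function -/

theorem integral_sign_sub_mul (f : C(ℝ, ℝ)) {v : ℝ} (hv : v ∈ Icc (0 : ℝ) 1) :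
    ∫ t in (0 : ℝ)..1, Real.sign (v - t) * f t = 2 * primitive f v - primitive f 1 := by
  have h1 : ∀ t ∈ Ioo 0 v, Real.sign (v - t) * f t = f t := fun t ht => by
    rw [Real.sign_of_pos (by linarith [ht.2]), one_mul]
  have h2 : ∀ t ∈ Ioo v 1, Real.sign (v - t) * f t = -f t := fun t ht => by
    rw [Real.sign_of_neg (by linarith [ht.1]), neg_one_mul]
  have i1 : IntervalIntegrable (fun t => Real.sign (v - t) * f t) volume 0 v :=
    (f.continuous.intervalIntegrable 0 v).congr_uIoo fun t ht => by
      rw [uIoo_of_le hv.1] at ht; exact (h1 t ht).symm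
  have i2 : IntervalIntegrable (fun t => Real.sign (v - t) * f t) volume v 1 :=
    (f.continuous.neg.intervalIntegrable v 1).congr_uIoo fun t ht => by
      rw [uIoo_of_le hv.2] at ht; exact (h2 t ht).symm
  rw [← intervalIntegral.integral_add_adjacent_intervals i1 i2,
    intervalIntegral.integral_congr_Ioo_of_le hv.1 h1,
    intervalIntegral.integral_congr_Ioo_of_le hv.2 h2, intervalIntegral.integral_neg,
    primitive_apply, primitive_apply,
    ← intervalIntegral.integral_add_adjacent_intervals (f.continuous.intervalIntegrable 0 v)
      (f.continuous.intervalIntegrable v 1)]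
  ring

theorem kendallTau_eq (F : C(ℝ × ℝ, ℝ)) :
    kendallTau (fun u v => F (u, v)) = ∫ u in (0 : ℝ)..1, ∫ v in (0 : ℝ)..1, F (u, v) *
      (4 * cumulative F (u, v) - 2 * cumulative F (u, 1) - 2 * cumulative F (1, v)
        + cumulative F (1, 1)) := by
  refine integral_zero_one_congr fun u hu => integral_zero_one_congr fun v hv => ?_
  have inner (s : ℝ) : ∫ t in (0 : ℝ)..1,
      Real.sign (u - s) * Real.sign (v - t) * F (u, v) * F (s, t) =
      F (u, v) * (Real.sign (u - s) *
        (2 * partialCumulative F (s, v) - partialCumulative F (s, 1))) := by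
    have := integral_sign_sub_mul ⟨fun t => F (s, t), by fun_prop⟩ hv
    simp only [ContinuousMap.coe_mk, primitive_apply] at this
    rw [partialCumulative_apply, partialCumulative_apply, ← this, ← mul_assoc,
      ← intervalIntegral.integral_const_mul]
    congr! 2; ring
  simp only [inner, intervalIntegral.integral_const_mul]
  have := integral_sign_sub_mul
    ⟨fun s => 2 * partialCumulative F (s, v) - partialCumulative F (s, 1), by fun_prop⟩ hu
  have hsub (w : ℝ) : ∫ s in (0 : ℝ)..w, (2 * partialCumulative F (s, v)
      - partialCumulative F (s, 1)) = 2 * cumulative F (w, v) - cumulative F (w, 1) := by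
    rw [intervalIntegral.integral_sub (Continuous.intervalIntegrable (by fun_prop) _ _)
      (Continuous.intervalIntegrable (by fun_prop) _ _), intervalIntegral.integral_const_mul]
    rfl
  simp only [ContinuousMap.coe_mk, primitive_apply, hsub] at this
  rw [this]
  ring

/-! ### Variations of a density and the Euler-Lagrange equation -/

/-- A continuous positive function on the plane whose slices have integral `1` over `[0, 1]`. -/
structure IsContinuousCopulaDensity (P : C(ℝ × ℝ, ℝ)) : Prop where
  pos : ∀ z, 0 < P z
  integral_left : ∀ v, ∫ u in (0 : ℝ)..1, P (u, v) = 1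
  integral_right : ∀ u, ∫ v in (0 : ℝ)..1, P (u, v) = 1

/-- A copula density extends to a continuous function on the plane by projecting each variable
onto `[0, 1]`. -/
theorem IsCopulaDensity.exists_extension {p : ℝ → ℝ → ℝ} (hp : IsCopulaDensity p) :
    ∃ P : C(ℝ × ℝ, ℝ), IsContinuousCopulaDensity P ∧
      ∀ u ∈ Icc (0 : ℝ) 1, ∀ v ∈ Icc (0 : ℝ) 1, P (u, v) = p u v := by
  set π : ℝ → ℝ := fun x => projIcc (0 : ℝ) 1 zero_le_one x with hπ
  have hπc : Continuous π := continuous_subtype_val.comp continuous_projIcc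
  have hπm (x : ℝ) : π x ∈ Icc (0 : ℝ) 1 := (projIcc (0 : ℝ) 1 zero_le_one x).2
  have hπe (x : ℝ) (hx : x ∈ Icc (0 : ℝ) 1) : π x = x := by
    simp [hπ, projIcc_of_mem zero_le_one hx]
  refine ⟨⟨fun z => Function.uncurry p (π z.1, π z.2),
    hp.smooth.continuousOn.comp_continuous (by fun_prop) fun z => ⟨hπm _, hπm _⟩⟩,
    ⟨fun z => hp.pos _ (hπm _) _ (hπm _), fun v => ?_, fun u => ?_⟩, fun u hu v hv => ?_⟩
  · exact (integral_zero_one_congr fun u hu => by simp [hπe u hu]).trans (hp.margU _ (hπm v))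
  · exact (integral_zero_one_congr fun v hv => by simp [hπe v hv]).trans (hp.margV _ (hπm u))
  · simp [hπe u hu, hπe v hv]

namespace IsContinuousCopulaDensity

variable {P : C(ℝ × ℝ, ℝ)}

theorem partialCumulative_right_one (hP : IsContinuousCopulaDensity P) (u : ℝ) : partialCumulative P (u, 1) = 1 :=
  hP.integral_right u

theorem cumulative_right_one (hP : IsContinuousCopulaDensity P) (u : ℝ) : cumulative P (u, 1) = u := by
  simp [cumulative_apply, hP.partialCumulative_right_one]

theorem cumulative_left_one (hP : IsContinuousCopulaDensity P) (v : ℝ) : cumulative P (1, v) = v := by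
  simp only [cumulative_apply, partialCumulative_apply]
  rw [integral_integral_comm]
  simp [hP.integral_left]

theorem squareIntegral_eq_one (hP : IsContinuousCopulaDensity P) : squareIntegral P = 1 := by
  simp [squareIntegral_apply, hP.integral_right]

end IsContinuousCopulaDensity

/-- The kernel `4H - 2u - 2v + 1` against which a distribution with uniform margins and
distribution function `H` is integrated in Kendall's functional. -/
noncomputable def concordance (H : C(ℝ × ℝ, ℝ)) : C(ℝ × ℝ, ℝ) :=
  ⟨fun z => 4 * H z - 2 * z.1 - 2 * z.2 + 1, by fun_prop⟩

@[simp] theorem concordance_apply (H : C(ℝ × ℝ, ℝ)) (z : ℝ × ℝ) :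
    concordance H z = 4 * H z - 2 * z.1 - 2 * z.2 + 1 := rfl

theorem kendallTau_eq_squareIntegral {F : C(ℝ × ℝ, ℝ)} (hr : ∀ u, cumulative F (u, 1) = u)
    (hl : ∀ v, cumulative F (1, v) = v) :
    kendallTau (fun u v => F (u, v)) = squareIntegral (F * concordance (cumulative F)) := by
  rw [kendallTau_eq, squareIntegral_apply]
  simp only [hr, hl, ContinuousMap.mul_apply, concordance_apply]

theorem squareIntegral_tensor_mul_concordance {f g : C(ℝ, ℝ)} (H : C(ℝ × ℝ, ℝ))
    (hf : ∫ x in (0 : ℝ)..1, f x = 0) (hg : ∫ x in (0 : ℝ)..1, g x = 0) :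
    squareIntegral (tensor f g * concordance H) = 4 * squareIntegral (tensor f g * H) := by
  have e : tensor f g * concordance H = (4 : ℝ) • (tensor f g * H)
      + (-2 : ℝ) • tensor (f * ContinuousMap.id ℝ) g + (-2 : ℝ) • tensor f (g * ContinuousMap.id ℝ)
      + tensor f g := by
    ext z
    simp; ring
  rw [e]
  simp [squareIntegral_tensor, hf, hg]

theorem squareIntegral_tensor_mul_tensor (f g f' g' : C(ℝ, ℝ)) :
    squareIntegral (tensor f g * tensor f' g') =
      (∫ x in (0 : ℝ)..1, f x * f' x) * ∫ x in (0 : ℝ)..1, g x * g' x := by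
  rw [show tensor f g * tensor f' g' = tensor (f * f') (g * g') by ext; simp; ring,
    squareIntegral_tensor]
  rfl

/-- Kendall's functional along a two-parameter family of perturbations of a density. -/
theorem kendallTau_variation {P : C(ℝ × ℝ, ℝ)} (hP : IsContinuousCopulaDensity P)
    (f g f₀ g₀ : C(ℝ, ℝ))
    (hf : ∫ x in (0 : ℝ)..1, f x = 0) (hg : ∫ x in (0 : ℝ)..1, g x = 0)
    (hf₀ : ∫ x in (0 : ℝ)..1, f₀ x = 0) (hg₀ : ∫ x in (0 : ℝ)..1, g₀ x = 0) :
    ∃ γ : ℝ, ∀ x y : ℝ,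
      kendallTau (fun u v => (P + x • tensor f g + y • tensor f₀ g₀) (u, v)) =
        kendallTau (fun u v => P (u, v)) + 8 * x * squareIntegral (tensor f g * cumulative P)
          + 8 * y * squareIntegral (tensor f₀ g₀ * cumulative P) + 4 * (x * y) * γ := by
  set Φ := tensor (primitive f) (primitive g) with hΦ
  set Φ₀ := tensor (primitive f₀) (primitive g₀) with hΦ₀
  refine ⟨squareIntegral (tensor f g * Φ₀) + squareIntegral (tensor f₀ g₀ * Φ), fun x y => ?_⟩
  have hcum : cumulative (P + x • tensor f g + y • tensor f₀ g₀) =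
      cumulative P + x • Φ + y • Φ₀ := by
    simp only [cumulative_add, cumulative_smul_tensor, hΦ, hΦ₀]
  have p1 : primitive f 1 = 0 := hf
  have p2 : primitive g 1 = 0 := hg
  have p3 : primitive f₀ 1 = 0 := hf₀
  have p4 : primitive g₀ 1 = 0 := hg₀
  rw [kendallTau_eq_squareIntegral hP.cumulative_right_one hP.cumulative_left_one,
    kendallTau_eq_squareIntegral
      (fun u => by rw [hcum]; simp [hΦ, hΦ₀, p2, p4, hP.cumulative_right_one])
      (fun v => by rw [hcum]; simp [hΦ, hΦ₀, p1, p3, hP.cumulative_left_one]), hcum]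
  have e : (P + x • tensor f g + y • tensor f₀ g₀) * concordance (cumulative P + x • Φ + y • Φ₀) =
      P * concordance (cumulative P) + (4 * x) • (P * Φ) + (4 * y) • (P * Φ₀)
      + x • (tensor f g * concordance (cumulative P))
      + y • (tensor f₀ g₀ * concordance (cumulative P))
      + (4 * x ^ 2) • (tensor f g * Φ) + (4 * (x * y)) • (tensor f g * Φ₀)
      + (4 * (x * y)) • (tensor f₀ g₀ * Φ) + (4 * y ^ 2) • (tensor f₀ g₀ * Φ₀) := by
    ext z
    simp; ring
  rw [e]
  simp only [map_add, map_smul, smul_eq_mul,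
    squareIntegral_tensor_mul_concordance _ hf hg, squareIntegral_tensor_mul_concordance _ hf₀ hg₀]
  have z1 : squareIntegral (tensor f g * Φ) = 0 := by
    rw [hΦ, squareIntegral_tensor_mul_tensor, integral_mul_primitive f hf, zero_mul]
  have z2 : squareIntegral (tensor f₀ g₀ * Φ₀) = 0 := by
    rw [hΦ₀, squareIntegral_tensor_mul_tensor, integral_mul_primitive f₀ hf₀, zero_mul]
  rw [z1, z2, hΦ, hΦ₀, squareIntegral_mul_tensor_primitive P f g hf hg,
    squareIntegral_mul_tensor_primitive P f₀ g₀ hf₀ hg₀]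
  ring

/-- The integrand `F log F` of the Shannon information. -/
noncomputable def mulLog (F : C(ℝ × ℝ, ℝ)) : C(ℝ × ℝ, ℝ) :=
  ⟨fun z => F z * Real.log (F z), Real.continuous_mul_log.comp F.continuous⟩

@[simp] theorem mulLog_apply (F : C(ℝ × ℝ, ℝ)) (z : ℝ × ℝ) :
    mulLog F z = F z * Real.log (F z) := rfl

/-- The logarithm of a positive continuous density. -/
noncomputable def logDensity {P : C(ℝ × ℝ, ℝ)} (hP : IsContinuousCopulaDensity P) :
    C(ℝ × ℝ, ℝ) :=
  ⟨fun z => Real.log (P z), P.continuous.log fun z => (hP.pos z).ne'⟩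

@[simp] theorem logDensity_apply {P : C(ℝ × ℝ, ℝ)} (hP : IsContinuousCopulaDensity P) (z : ℝ × ℝ) :
    logDensity hP z = Real.log (P z) := rfl

theorem add_mul_log_add_le {a k : ℝ} (ha : 0 < a) (hk : 0 < a + k) :
    (a + k) * Real.log (a + k) ≤ a * Real.log a + k * (Real.log a + 1) + k ^ 2 / a := by
  have h := Real.log_le_sub_one_of_pos (div_pos hk ha)
  rw [Real.log_div hk.ne' ha.ne'] at h
  have h1 : Real.log (a + k) ≤ Real.log a + k / a := by
    have : (a + k) / a - 1 = k / a := by field_simp; ring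
    linarith
  refine (mul_le_mul_of_nonneg_left h1 hk.le).trans_eq ?_
  field_simp
  ring

theorem exists_abs_le_mul {P : C(ℝ × ℝ, ℝ)} (hP : IsContinuousCopulaDensity P)
    (h : C(ℝ × ℝ, ℝ)) :
    ∃ M : ℝ, ∀ u ∈ Icc (0 : ℝ) 1, ∀ v ∈ Icc (0 : ℝ) 1, |h (u, v)| ≤ M * P (u, v) := by
  obtain ⟨M, hM⟩ := (isCompact_Icc.prod isCompact_Icc : IsCompact
    (Icc (0 : ℝ) 1 ×ˢ Icc (0 : ℝ) 1)).exists_bound_of_continuousOn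
    (f := fun z => h z / P z)
    ((h.continuous.div P.continuous fun z => (hP.pos z).ne').continuousOn)
  refine ⟨M, fun u hu v hv => ?_⟩
  have := hM (u, v) ⟨hu, hv⟩
  rwa [Real.norm_eq_abs, abs_div, abs_of_pos (hP.pos _), div_le_iff₀ (hP.pos _)] at this

/-- First-order condition for the constrained minimization, with one auxiliary direction used to
restore the constraint. -/
theorem squareIntegral_mul_log_eq_of_isMin {P : C(ℝ × ℝ, ℝ)} (hP : IsContinuousCopulaDensity P)
    (f g f₀ g₀ : C(ℝ, ℝ))
    (hf : ∫ x in (0 : ℝ)..1, f x = 0) (hg : ∫ x in (0 : ℝ)..1, g x = 0)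
    (hf₀ : ∫ x in (0 : ℝ)..1, f₀ x = 0) (hg₀ : ∫ x in (0 : ℝ)..1, g₀ x = 0)
    (hβ : squareIntegral (tensor f₀ g₀ * cumulative P) ≠ 0)
    (hmin : ∀ x y : ℝ,
      (∀ u ∈ Icc (0 : ℝ) 1, ∀ v ∈ Icc (0 : ℝ) 1,
        0 < (P + x • tensor f g + y • tensor f₀ g₀) (u, v)) →
      kendallTau (fun u v => (P + x • tensor f g + y • tensor f₀ g₀) (u, v)) =
        kendallTau (fun u v => P (u, v)) →
      squareIntegral (mulLog P) ≤
        squareIntegral (mulLog (P + x • tensor f g + y • tensor f₀ g₀))) :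
    squareIntegral (tensor f g * logDensity hP) =
      squareIntegral (tensor f₀ g₀ * logDensity hP) /
        squareIntegral (tensor f₀ g₀ * cumulative P) *
          squareIntegral (tensor f g * cumulative P) := by
  obtain ⟨γ, hγ⟩ := kendallTau_variation hP f g f₀ g₀ hf hg hf₀ hg₀
  obtain ⟨M, hM⟩ := exists_abs_le_mul hP (tensor f g)
  obtain ⟨M₀, hM₀⟩ := exists_abs_le_mul hP (tensor f₀ g₀)
  set α := squareIntegral (tensor f g * cumulative P)
  set β := squareIntegral (tensor f₀ g₀ * cumulative P)
  set l := squareIntegral (tensor f g * logDensity hP) with hl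
  set l₀ := squareIntegral (tensor f₀ g₀ * logDensity hP) with hl₀
  let y : ℝ → ℝ := fun x => -2 * α * x / (2 * β + γ * x)
  have hden0 : 2 * β + γ * 0 ≠ 0 := by simpa using hβ
  have hy : HasDerivAt y (-(α / β)) 0 := by
    refine (((hasDerivAt_id (0 : ℝ)).const_mul (-2 * α)).div
      (((hasDerivAt_id (0 : ℝ)).const_mul γ).const_add (2 * β)) hden0).congr_deriv ?_
    simp only [id]
    field_simp
    ring
  have hy0 : y 0 = 0 := by simp [y]
  have hden : ∀ᶠ x in 𝓝 (0 : ℝ), 2 * β + γ * x ≠ 0 :=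
    (Continuous.continuousAt (by fun_prop)).eventually_ne hden0
  have hsmall : ∀ᶠ x in 𝓝 (0 : ℝ), |x| * M + |y x| * M₀ < 1 := by
    have hc : ContinuousAt (fun x => |x| * M + |y x| * M₀) 0 :=
      (continuousAt_id.abs.mul continuousAt_const).add (hy.continuousAt.abs.mul continuousAt_const)
    exact hc.eventually_lt continuousAt_const (by simp [hy0])
  let φ : ℝ → ℝ := fun x => x * l + y x * l₀ + (2 * M ^ 2 * x ^ 2 + 2 * M₀ ^ 2 * y x ^ 2)
  have hφ0 : φ 0 = 0 := by simp [φ, hy0]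
  have hφmin : IsLocalMin φ 0 := by
    filter_upwards [hden, hsmall] with x hx hx1
    rw [hφ0]
    have hb (u : ℝ) (hu : u ∈ Icc (0 : ℝ) 1) (v : ℝ) (hv : v ∈ Icc (0 : ℝ) 1) :
        |x * tensor f g (u, v)| ≤ |x| * M * P (u, v) ∧
        |y x * tensor f₀ g₀ (u, v)| ≤ |y x| * M₀ * P (u, v) := by
      rw [abs_mul, abs_mul, mul_assoc, mul_assoc]
      exact ⟨mul_le_mul_of_nonneg_left (hM u hu v hv) (abs_nonneg _),
        mul_le_mul_of_nonneg_left (hM₀ u hu v hv) (abs_nonneg _)⟩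
    have hpos : ∀ u ∈ Icc (0 : ℝ) 1, ∀ v ∈ Icc (0 : ℝ) 1,
        0 < P (u, v) + (x * tensor f g (u, v) + y x * tensor f₀ g₀ (u, v)) := by
      intro u hu v hv
      obtain ⟨h1, h2⟩ := hb u hu v hv
      have h3 := mul_lt_mul_of_pos_right hx1 (hP.pos (u, v))
      linarith [neg_abs_le (x * tensor f g (u, v)), neg_abs_le (y x * tensor f₀ g₀ (u, v))]
    have hle := hmin x (y x)
      (fun u hu v hv => by
        have := hpos u hu v hv
        simpa [add_assoc] using this)
      (by
        rw [hγ]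
        have hyx : y x * (2 * β + γ * x) = -2 * α * x := div_mul_cancel₀ _ hx
        linear_combination 4 * hyx)
    have hupper : squareIntegral (mulLog (P + x • tensor f g + y x • tensor f₀ g₀)) ≤
        squareIntegral (mulLog P + x • (tensor f g * logDensity hP) + x • tensor f g
          + y x • (tensor f₀ g₀ * logDensity hP) + y x • tensor f₀ g₀
          + (2 * M ^ 2 * x ^ 2 + 2 * M₀ ^ 2 * y x ^ 2) • P) := by
      refine squareIntegral_mono fun u hu v hv => ?_
      have hPpos := hP.pos (u, v)
      have h0 := add_mul_log_add_le hPpos (hpos u hu v hv)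
      obtain ⟨h1, h2⟩ := hb u hu v hv
      have h3 : (x * tensor f g (u, v) + y x * tensor f₀ g₀ (u, v)) ^ 2 / P (u, v) ≤
          (2 * M ^ 2 * x ^ 2 + 2 * M₀ ^ 2 * y x ^ 2) * P (u, v) := by
        rw [div_le_iff₀ hPpos]
        have q1 := sq_le_sq' (by linarith [neg_abs_le (x * tensor f g (u, v))])
          ((le_abs_self _).trans h1)
        have q2 := sq_le_sq' (by linarith [neg_abs_le (y x * tensor f₀ g₀ (u, v))])
          ((le_abs_self _).trans h2)
        simp only [mul_pow _ _ 2, sq_abs] at q1 q2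
        nlinarith [sq_nonneg (x * tensor f g (u, v) - y x * tensor f₀ g₀ (u, v))]
      simp only [tensor_apply] at h0 h3
      simp only [mulLog_apply, ContinuousMap.add_apply, ContinuousMap.smul_apply, smul_eq_mul,
        ContinuousMap.mul_apply, logDensity_apply, tensor_apply]
      rw [add_assoc (P (u, v))]
      linarith
    simp only [map_add, map_smul, smul_eq_mul, squareIntegral_tensor, hf, hf₀,
      hP.squareIntegral_eq_one, ← hl, ← hl₀] at hupper
    simp only [φ]
    linarith
  have hφ' : HasDerivAt φ (l + -(α / β) * l₀) 0 := by
    refine ((((hasDerivAt_id (0 : ℝ)).mul_const l).add (hy.mul_const l₀)).add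
      ((((hasDerivAt_id (0 : ℝ)).pow 2).const_mul (2 * M ^ 2)).add
        ((hy.pow 2).const_mul (2 * M₀ ^ 2)))).congr_deriv ?_
    simp [hy0]
  have := hφmin.hasDerivAt_eq_zero hφ'
  have e : l = α / β * l₀ := by linarith
  rw [e]; ring

/-- The Euler-Lagrange equation: the logarithm of a minimizer is an affine function of its
distribution function, up to functions of one variable. -/
theorem exists_log_eq_of_isMin {p : ℝ → ℝ → ℝ} (hp : IsCopulaDensity p)
    (hmin : ∀ q : ℝ → ℝ → ℝ, IsCopulaDensity q → kendallTau q = kendallTau p →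
      shannonInfo p ≤ shannonInfo q)
    {P : C(ℝ × ℝ, ℝ)} (hP : IsContinuousCopulaDensity P)
    (hPp : ∀ u ∈ Icc (0 : ℝ) 1, ∀ v ∈ Icc (0 : ℝ) 1, P (u, v) = p u v) :
    ∃ c : ℝ, ∀ u ∈ Icc (0 : ℝ) 1, ∀ v ∈ Icc (0 : ℝ) 1,
      Real.log (P (u, v)) = c * cumulative P (u, v) + Real.log (P (u, 0))
        + Real.log (P (0, v)) - Real.log (P (0, 0)) := by
  have kendall_congr {q : ℝ → ℝ → ℝ} {Q : C(ℝ × ℝ, ℝ)}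
      (h : ∀ u ∈ Icc (0 : ℝ) 1, ∀ v ∈ Icc (0 : ℝ) 1, Q (u, v) = q u v) :
      kendallTau (fun u v => Q (u, v)) = kendallTau q := by
    refine integral_zero_one_congr fun u hu => integral_zero_one_congr fun v hv =>
      integral_zero_one_congr fun s hs => integral_zero_one_congr fun t ht => ?_
    simp only [h u hu v hv, h s hs t ht]
  have shannon_congr {q : ℝ → ℝ → ℝ} {Q : C(ℝ × ℝ, ℝ)}
      (h : ∀ u ∈ Icc (0 : ℝ) 1, ∀ v ∈ Icc (0 : ℝ) 1, Q (u, v) = q u v) :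
      squareIntegral (mulLog Q) = shannonInfo q := by
    refine integral_zero_one_congr fun u hu => integral_zero_one_congr fun v hv => ?_
    rw [mulLog_apply, h u hu v hv]
  obtain ⟨f₀, g₀, hf₀s, hg₀s, hf₀, hg₀, hβ⟩ : ∃ f₀ g₀ : C(ℝ, ℝ), ContDiff ℝ ∞ f₀ ∧
      ContDiff ℝ ∞ g₀ ∧ ∫ x in (0 : ℝ)..1, f₀ x = 0 ∧ ∫ x in (0 : ℝ)..1, g₀ x = 0 ∧
      squareIntegral (tensor f₀ g₀ * cumulative P) ≠ 0 := by
    by_contra! hcon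
    have := separable_of_squareIntegral_eq_zero (cumulative P)
      (fun f g hfs hgs hf hg => hcon f g hfs hgs hf hg)
      (right_mem_Icc.2 zero_le_one) (right_mem_Icc.2 zero_le_one)
    simp [hP.cumulative_right_one] at this
  refine ⟨squareIntegral (tensor f₀ g₀ * logDensity hP) /
    squareIntegral (tensor f₀ g₀ * cumulative P), fun u hu v hv => ?_⟩
  set c := squareIntegral (tensor f₀ g₀ * logDensity hP) /
    squareIntegral (tensor f₀ g₀ * cumulative P) with hc
  have hsep := separable_of_squareIntegral_eq_zero (logDensity hP - c • cumulative P)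
    (fun f g hfs hgs hf hg => ?_) hu hv
  · simp at hsep
    linarith
  · have := squareIntegral_mul_log_eq_of_isMin hP f g f₀ g₀ hf hg hf₀ hg₀ hβ fun x y hpos hK => ?_
    · rw [mul_sub, mul_smul_comm, map_sub, map_smul, this, smul_eq_mul, sub_self]
    set q : ℝ → ℝ → ℝ := fun u v => p u v + x * (f u * g v) + y * (f₀ u * g₀ v) with hq
    have hQq : ∀ u ∈ Icc (0 : ℝ) 1, ∀ v ∈ Icc (0 : ℝ) 1,
        (P + x • tensor f g + y • tensor f₀ g₀) (u, v) = q u v := fun u hu v hv => by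
      simp [hq, hPp u hu v hv]
    rw [shannon_congr hPp, shannon_congr hQq]
    refine hmin q ⟨?_, fun u hu v hv => ?_, fun v hv => ?_, fun u hu => ?_⟩ ?_
    · have s1 := (contDiff_infty.1 hfs 2).comp (contDiff_fst (E := ℝ) (F := ℝ))
      have s2 := (contDiff_infty.1 hgs 2).comp (contDiff_snd (E := ℝ) (F := ℝ))
      have s3 := (contDiff_infty.1 hf₀s 2).comp (contDiff_fst (E := ℝ) (F := ℝ))
      have s4 := (contDiff_infty.1 hg₀s 2).comp (contDiff_snd (E := ℝ) (F := ℝ))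
      exact (hp.smooth.add (contDiff_const.mul (s1.mul s2)).contDiffOn).add
        (contDiff_const.mul (s3.mul s4)).contDiffOn
    · rw [← hQq u hu v hv]; exact hpos u hu v hv
    · rw [← integral_zero_one_congr fun u hu => hQq u hu v hv]
      simp only [ContinuousMap.add_apply, ContinuousMap.smul_apply, tensor_apply, smul_eq_mul]
      rw [intervalIntegral.integral_add (Continuous.intervalIntegrable (by fun_prop) _ _)
          (Continuous.intervalIntegrable (by fun_prop) _ _),
        intervalIntegral.integral_add (Continuous.intervalIntegrable (by fun_prop) _ _)
          (Continuous.intervalIntegrable (by fun_prop) _ _)]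
      simp [hP.integral_left, hf, hf₀]
    · rw [← integral_zero_one_congr fun v hv => hQq u hu v hv]
      simp only [ContinuousMap.add_apply, ContinuousMap.smul_apply, tensor_apply, smul_eq_mul]
      rw [intervalIntegral.integral_add (Continuous.intervalIntegrable (by fun_prop) _ _)
          (Continuous.intervalIntegrable (by fun_prop) _ _),
        intervalIntegral.integral_add (Continuous.intervalIntegrable (by fun_prop) _ _)
          (Continuous.intervalIntegrable (by fun_prop) _ _)]
      simp [hP.integral_right, hg, hg₀]
    · rw [← kendall_congr hPp, ← kendall_congr hQq, hK]

/-! ### Solving the Euler-Lagrange equation -/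

theorem eq_left_of_hasDerivAt_zero {f : ℝ → ℝ} (hf : Continuous f)
    (h : ∀ x ∈ Ioo (0 : ℝ) 1, HasDerivAt f 0 x) {x : ℝ} (hx : x ∈ Icc (0 : ℝ) 1) : f x = f 0 := by
  rcases hx.1.eq_or_lt with rfl | hx0
  · rfl
  obtain ⟨c, -, hc⟩ := exists_hasDerivAt_eq_slope f (fun _ => 0) hx0 hf.continuousOn
    fun y hy => h y ⟨hy.1, hy.2.trans_le hx.2⟩
  rw [eq_comm, div_eq_zero_iff] at hc
  rcases hc with hc | hc <;> linarith

theorem IsCopulaDensity.contDiffOn_log {p : ℝ → ℝ → ℝ} (hp : IsCopulaDensity p)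
    {P : C(ℝ × ℝ, ℝ)}
    (hPp : ∀ u ∈ Icc (0 : ℝ) 1, ∀ v ∈ Icc (0 : ℝ) 1, P (u, v) = p u v) :
    ContDiffOn ℝ 1 (fun u => Real.log (P (u, 0))) (Ioo 0 1) := by
  have h0 : (0 : ℝ) ∈ Icc (0 : ℝ) 1 := left_mem_Icc.2 zero_le_one
  have hs : ContDiffOn ℝ 1 (fun u => p u 0) (Ioo 0 1) :=
    (hp.smooth.of_le one_le_two).comp (g := Function.uncurry p) (f := fun u : ℝ => (u, (0 : ℝ)))
      (by fun_prop) fun u hu => ⟨Ioo_subset_Icc_self hu, h0⟩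
  refine (hs.log fun u hu => (hp.pos u (Ioo_subset_Icc_self hu) 0 h0).ne').congr fun u hu => ?_
  rw [hPp u (Ioo_subset_Icc_self hu) 0 h0]

/-- The conditional distribution function of a solution of the Euler-Lagrange equation satisfies
a Riccati equation in the conditioning variable. -/
theorem hasDerivAt_partialCumulative_left {P : C(ℝ × ℝ, ℝ)} (hP : IsContinuousCopulaDensity P)
    {θ : ℝ} (hlog : ∀ u ∈ Icc (0 : ℝ) 1, ∀ v ∈ Icc (0 : ℝ) 1,
      Real.log (P (u, v)) = 2 * θ * cumulative P (u, v) + Real.log (P (u, 0))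
        + Real.log (P (0, v)) - Real.log (P (0, 0)))
    (hsmooth : ContDiffOn ℝ 1 (fun u => Real.log (P (u, 0))) (Ioo 0 1))
    {u : ℝ} (hu : u ∈ Ioo (0 : ℝ) 1) {v : ℝ} (hv : v ∈ Icc (0 : ℝ) 1) :
    HasDerivAt (fun x => partialCumulative P (x, v))
      (θ * partialCumulative P (u, v) ^ 2
        + deriv (fun u => Real.log (P (u, 0))) u * partialCumulative P (u, v)) u := by
  set a' := deriv (fun u => Real.log (P (u, 0))) with ha'
  have ha (x : ℝ) (hx : x ∈ Ioo (0 : ℝ) 1) :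
      HasDerivAt (fun u => Real.log (P (u, 0))) (a' x) x :=
    ((hsmooth.differentiableOn one_ne_zero).differentiableAt (isOpen_Ioo.mem_nhds hx)).hasDerivAt
  have ha'c : ContinuousAt a' u :=
    (hsmooth.continuousOn_deriv_of_isOpen isOpen_Ioo le_rfl).continuousAt (isOpen_Ioo.mem_nhds hu)
  have hdiff (x : ℝ) (hx : x ∈ Ioo (0 : ℝ) 1) (t : ℝ) (ht : t ∈ Icc (0 : ℝ) 1) :
      HasDerivAt (fun x => P (x, t)) (P (x, t) * (2 * θ * partialCumulative P (x, t) + a' x)) x := by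
    have h1 (y : ℝ) (hy : y ∈ Ioo (0 : ℝ) 1) : P (y, t) = Real.exp (2 * θ * cumulative P (y, t)
        + Real.log (P (y, 0)) + Real.log (P (0, t)) - Real.log (P (0, 0))) := by
      rw [← hlog y (Ioo_subset_Icc_self hy) t ht, Real.exp_log (hP.pos _)]
    have h2 := (((((hasDerivAt_cumulative P x t).const_mul (2 * θ)).add (ha x hx)).add_const
      (Real.log (P (0, t)))).sub_const (Real.log (P (0, 0)))).exp
    rw [h1 x hx]
    exact h2.congr_of_eventuallyEq
      (Filter.eventually_of_mem (isOpen_Ioo.mem_nhds hx) h1)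
  have hcomp : IsCompact (Icc (0 : ℝ) 1 ×ˢ Icc (0 : ℝ) 1) := isCompact_Icc.prod isCompact_Icc
  obtain ⟨B₁, hB₁⟩ := hcomp.exists_bound_of_continuousOn P.continuous.continuousOn
  obtain ⟨B₂, hB₂⟩ := hcomp.exists_bound_of_continuousOn
    (P * partialCumulative P).continuous.continuousOn
  have hloc : ∀ᶠ x in 𝓝 u, |a' x| < |a' u| + 1 :=
    ha'c.abs.eventually_lt continuousAt_const (lt_add_one _)
  have ht01 {t : ℝ} (ht : t ∈ uIoc 0 v) : t ∈ Icc (0 : ℝ) 1 := by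
    rw [uIoc_of_le hv.1] at ht
    exact ⟨ht.1.le, ht.2.trans hv.2⟩
  have main := (intervalIntegral.hasDerivAt_integral_of_dominated_loc_of_deriv_le
    (μ := volume) (a := 0) (b := v) (F := fun x t => P (x, t))
    (F' := fun x t => P (x, t) * (2 * θ * partialCumulative P (x, t) + a' x)) (x₀ := u)
    (bound := fun _ => 2 * |θ| * B₂ + B₁ * (|a' u| + 1))
    (s := Ioo 0 1 ∩ {x | |a' x| < |a' u| + 1})
    (inter_mem (isOpen_Ioo.mem_nhds hu) hloc)
    (Eventually.of_forall fun x => Continuous.aestronglyMeasurable (by fun_prop))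
    (Continuous.intervalIntegrable (by fun_prop) _ _)
    (Continuous.aestronglyMeasurable (by fun_prop))
    (Eventually.of_forall fun t ht x hx => by
      have hz : (x, t) ∈ Icc (0 : ℝ) 1 ×ˢ Icc (0 : ℝ) 1 := ⟨Ioo_subset_Icc_self hx.1, ht01 ht⟩
      have b1 := hB₁ _ hz
      have b2 := hB₂ _ hz
      have b3 : |a' x| < |a' u| + 1 := hx.2
      simp only [ContinuousMap.mul_apply, Real.norm_eq_abs] at b1 b2 ⊢
      calc |P (x, t) * (2 * θ * partialCumulative P (x, t) + a' x)|
          = |2 * θ * (P (x, t) * partialCumulative P (x, t)) + P (x, t) * a' x| := by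
            congr 1; ring
        _ ≤ |2 * θ * (P (x, t) * partialCumulative P (x, t))| + |P (x, t) * a' x| :=
            abs_add_le _ _
        _ = 2 * |θ| * |P (x, t) * partialCumulative P (x, t)| + |P (x, t)| * |a' x| := by
            rw [abs_mul (2 * θ), abs_mul 2 θ, abs_two, abs_mul (P (x, t)) (a' x)]
        _ ≤ _ := add_le_add (mul_le_mul_of_nonneg_left b2 (by positivity))
            (mul_le_mul b1 b3.le (abs_nonneg _) ((abs_nonneg _).trans b1)))
    (by simp)
    (Eventually.of_forall fun t ht x hx => hdiff x hx.1 t (ht01 ht))).2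
  refine main.congr_deriv ?_
  have hanti (t : ℝ) : HasDerivAt (fun t => θ * partialCumulative P (u, t) ^ 2
      + a' u * partialCumulative P (u, t))
      (P (u, t) * (2 * θ * partialCumulative P (u, t) + a' u)) t := by
    have h := hasDerivAt_partialCumulative P u t
    refine (((h.pow 2).const_mul θ).add (h.const_mul (a' u))).congr_deriv ?_
    simp; ring
  rw [intervalIntegral.integral_eq_sub_of_hasDerivAt (fun t _ => hanti t)
    (Continuous.intervalIntegrable (by fun_prop) _ _)]
  simp

/-- After identifying the one-variable terms, the Riccati equation is logistic. -/
theorem hasDerivAt_partialCumulative_logistic {P : C(ℝ × ℝ, ℝ)}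
    (hP : IsContinuousCopulaDensity P) {θ : ℝ}
    (hlog : ∀ u ∈ Icc (0 : ℝ) 1, ∀ v ∈ Icc (0 : ℝ) 1,
      Real.log (P (u, v)) = 2 * θ * cumulative P (u, v) + Real.log (P (u, 0))
        + Real.log (P (0, v)) - Real.log (P (0, 0)))
    (hsmooth : ContDiffOn ℝ 1 (fun u => Real.log (P (u, 0))) (Ioo 0 1))
    {u : ℝ} (hu : u ∈ Ioo (0 : ℝ) 1) {v : ℝ} (hv : v ∈ Icc (0 : ℝ) 1) :
    HasDerivAt (fun x => partialCumulative P (x, v))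
      (θ * (partialCumulative P (u, v) ^ 2 - partialCumulative P (u, v))) u := by
  have h1 := hasDerivAt_partialCumulative_left hP hlog hsmooth hu (right_mem_Icc.2 zero_le_one)
  simp only [hP.partialCumulative_right_one] at h1
  have h2 := h1.unique (hasDerivAt_const u (1 : ℝ))
  refine (hasDerivAt_partialCumulative_left hP hlog hsmooth hu hv).congr_deriv ?_
  linear_combination partialCumulative P (u, v) * h2

/-- `1 - (1 - e^{-θu}) (1 - e^{-θv}) / (1 - e^{-θ})`, the exponential of `-θ` times the Frank
distribution function. -/
noncomputable def frankExp (θ u v : ℝ) : ℝ :=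
  1 - (1 - Real.exp (-θ * v)) / (1 - Real.exp (-θ)) * (1 - Real.exp (-θ * u))

theorem one_sub_exp_neg_ne_zero {θ : ℝ} (hθ : θ ≠ 0) : 1 - Real.exp (-θ) ≠ 0 := by
  rw [sub_ne_zero, ne_comm, Ne, Real.exp_eq_one_iff]
  simpa using hθ

theorem hasDerivAt_exp_neg_mul (θ x : ℝ) :
    HasDerivAt (fun x => Real.exp (-θ * x)) (-θ * Real.exp (-θ * x)) x := by
  refine (((hasDerivAt_id x).const_mul (-θ)).exp).congr_deriv ?_
  simp; ring

theorem frank_cumulative {P : C(ℝ × ℝ, ℝ)} (hP : IsContinuousCopulaDensity P) {θ : ℝ}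
    (hθ : θ ≠ 0)
    (hE : ∀ u ∈ Ioo (0 : ℝ) 1, ∀ v ∈ Icc (0 : ℝ) 1,
      HasDerivAt (fun x => partialCumulative P (x, v))
        (θ * (partialCumulative P (u, v) ^ 2 - partialCumulative P (u, v))) u)
    {u : ℝ} (hu : u ∈ Icc (0 : ℝ) 1) {v : ℝ} (hv : v ∈ Icc (0 : ℝ) 1) :
    Real.exp (-θ * cumulative P (u, v)) = frankExp θ u v ∧
      partialCumulative P (u, v) * frankExp θ u v =
        Real.exp (-θ * u) * ((1 - Real.exp (-θ * v)) / (1 - Real.exp (-θ))) := by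
  have hw (x : ℝ) : HasDerivAt (fun x => Real.exp (-θ * cumulative P (x, v)))
      (-θ * partialCumulative P (x, v) * Real.exp (-θ * cumulative P (x, v))) x := by
    refine (((hasDerivAt_cumulative P x v).const_mul (-θ)).exp).congr_deriv ?_
    ring
  set k := partialCumulative P (0, v) with hk
  have first (x : ℝ) (hx : x ∈ Icc (0 : ℝ) 1) : partialCumulative P (x, v)
      * Real.exp (-θ * cumulative P (x, v)) * Real.exp (θ * x) = k := by
    have := eq_left_of_hasDerivAt_zero
      (f := fun x => partialCumulative P (x, v)
        * Real.exp (-θ * cumulative P (x, v)) * Real.exp (θ * x)) (by fun_prop)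
      (fun y hy => by
        refine (((hE y hy v hv).mul (hw y)).mul
          (((hasDerivAt_id y).const_mul θ).exp)).congr_deriv ?_
        simp; ring) hx
    simpa [hk] using this
  have first' (x : ℝ) (hx : x ∈ Icc (0 : ℝ) 1) : partialCumulative P (x, v)
      * Real.exp (-θ * cumulative P (x, v)) = k * Real.exp (-θ * x) := by
    rw [← first x hx, mul_assoc _ (Real.exp (θ * x)), ← Real.exp_add]
    simp
  have second (x : ℝ) (hx : x ∈ Icc (0 : ℝ) 1) :
      Real.exp (-θ * cumulative P (x, v)) = 1 - k * (1 - Real.exp (-θ * x)) := by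
    have := eq_left_of_hasDerivAt_zero
      (f := fun x => Real.exp (-θ * cumulative P (x, v)) - k * Real.exp (-θ * x)) (by fun_prop)
      (fun y hy => by
        refine ((hw y).sub ((hasDerivAt_exp_neg_mul θ y).const_mul k)).congr_deriv ?_
        linear_combination -θ * first' y (Ioo_subset_Icc_self hy)) hx
    simp only [cumulative_left_zero, mul_zero, Real.exp_zero] at this
    linarith
  have hk' : k = (1 - Real.exp (-θ * v)) / (1 - Real.exp (-θ)) := by
    have := second 1 (right_mem_Icc.2 zero_le_one)
    rw [hP.cumulative_left_one, mul_one] at this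
    rw [eq_div_iff (one_sub_exp_neg_ne_zero hθ)]
    linarith
  have hw' : Real.exp (-θ * cumulative P (u, v)) = frankExp θ u v := by
    rw [second u hu, frankExp, hk']
  refine ⟨hw', ?_⟩
  rw [← hw', first' u hu, hk', mul_comm]

theorem hasDerivAt_frankExp (θ u v : ℝ) :
    HasDerivAt (fun v => frankExp θ u v)
      (-(θ * Real.exp (-θ * v) / (1 - Real.exp (-θ)) * (1 - Real.exp (-θ * u)))) v := by
  refine (((((hasDerivAt_exp_neg_mul θ v).const_sub 1).div_const
    (1 - Real.exp (-θ))).mul_const (1 - Real.exp (-θ * u))).const_sub 1).congr_deriv ?_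
  ring

theorem eq_deriv_partialCumulative {P : C(ℝ × ℝ, ℝ)} {u v d : ℝ} {e : ℝ → ℝ}
    (hv : v ∈ Icc (0 : ℝ) 1) (he : ∀ t ∈ Icc (0 : ℝ) 1, partialCumulative P (u, t) = e t)
    (hd : HasDerivAt e d v) : P (u, v) = d :=
  (uniqueDiffOn_Icc zero_lt_one v hv).eq_deriv _
    (hasDerivAt_partialCumulative P u v).hasDerivWithinAt
    (hd.hasDerivWithinAt.congr he (he v hv))

theorem density_eq {P : C(ℝ × ℝ, ℝ)} (hP : IsContinuousCopulaDensity P) {θ : ℝ} (hθ : θ ≠ 0)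
    (hE : ∀ u ∈ Ioo (0 : ℝ) 1, ∀ v ∈ Icc (0 : ℝ) 1,
      HasDerivAt (fun x => partialCumulative P (x, v))
        (θ * (partialCumulative P (u, v) ^ 2 - partialCumulative P (u, v))) u)
    {u : ℝ} (hu : u ∈ Icc (0 : ℝ) 1) {v : ℝ} (hv : v ∈ Icc (0 : ℝ) 1) :
    P (u, v) = Real.exp (-θ * u) * (θ * Real.exp (-θ * v) / (1 - Real.exp (-θ))) /
      frankExp θ u v ^ 2 := by
  have hpos (t : ℝ) (ht : t ∈ Icc (0 : ℝ) 1) : frankExp θ u t ≠ 0 := by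
    rw [← (frank_cumulative hP hθ hE hu ht).1]
    exact (Real.exp_pos _).ne'
  refine eq_deriv_partialCumulative hv
    (e := fun t => Real.exp (-θ * u) * ((1 - Real.exp (-θ * t)) / (1 - Real.exp (-θ))) /
      frankExp θ u t) (fun t ht => ?_) ?_
  · rw [eq_div_iff (hpos t ht)]
    exact (frank_cumulative hP hθ hE hu ht).2
  · refine (((((hasDerivAt_exp_neg_mul θ v).const_sub 1).div_const
      (1 - Real.exp (-θ))).const_mul (Real.exp (-θ * u))).div
      (hasDerivAt_frankExp θ u v) (hpos v hv)).congr_deriv ?_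
    congr 1
    simp only [frankExp]
    ring

theorem density_eq_frankDensity {P : C(ℝ × ℝ, ℝ)} (hP : IsContinuousCopulaDensity P) {θ : ℝ}
    (hθ : θ ≠ 0)
    (hE : ∀ u ∈ Ioo (0 : ℝ) 1, ∀ v ∈ Icc (0 : ℝ) 1,
      HasDerivAt (fun x => partialCumulative P (x, v))
        (θ * (partialCumulative P (u, v) ^ 2 - partialCumulative P (u, v))) u)
    {u : ℝ} (hu : u ∈ Icc (0 : ℝ) 1) {v : ℝ} (hv : v ∈ Icc (0 : ℝ) 1) :
    P (u, v) = frankDensity θ u v := by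
  have h1 := one_sub_exp_neg_ne_zero hθ
  have hw : frankExp θ u v ≠ 0 := by
    rw [← (frank_cumulative hP hθ hE hu hv).1]
    exact (Real.exp_pos _).ne'
  have e : 1 - Real.exp (-θ) - (1 - Real.exp (-θ * u)) * (1 - Real.exp (-θ * v)) =
      (1 - Real.exp (-θ)) * frankExp θ u v := by
    rw [frankExp]; field_simp
  rw [density_eq hP hθ hE hu hv, frankDensity, e, mul_add, Real.exp_add]
  field_simp

theorem kendallTau_eq_four_mul_sub_one {P : C(ℝ × ℝ, ℝ)} (hP : IsContinuousCopulaDensity P) :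
    kendallTau (fun u v => P (u, v)) = 4 * squareIntegral (P * cumulative P) - 1 := by
  rw [kendallTau_eq_squareIntegral hP.cumulative_right_one hP.cumulative_left_one]
  set U : C(ℝ × ℝ, ℝ) := ⟨fun z => z.1, by fun_prop⟩ with hU
  set V : C(ℝ × ℝ, ℝ) := ⟨fun z => z.2, by fun_prop⟩ with hV
  have e : P * concordance (cumulative P) = (4 : ℝ) • (P * cumulative P)
      - (2 : ℝ) • (P * U) - (2 : ℝ) • (P * V) + P := by
    ext z
    simp [hU, hV]; ring
  have h1 : squareIntegral (P * U) = 1 / 2 := by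
    simp [squareIntegral_apply, hU, hP.integral_right]
  have h2 : squareIntegral (P * V) = 1 / 2 := by
    simp [squareIntegral_swap, hV, hP.integral_left]
  rw [e]
  simp only [map_add, map_sub, map_smul, smul_eq_mul, h1, h2, hP.squareIntegral_eq_one]
  ring

theorem kendallTau_eq_zero_of_hasDerivAt_zero {P : C(ℝ × ℝ, ℝ)}
    (hP : IsContinuousCopulaDensity P)
    (hE : ∀ u ∈ Ioo (0 : ℝ) 1, ∀ v ∈ Icc (0 : ℝ) 1,
      HasDerivAt (fun x => partialCumulative P (x, v)) 0 u) :
    kendallTau (fun u v => P (u, v)) = 0 := by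
  have h0 (u : ℝ) (hu : u ∈ Icc (0 : ℝ) 1) (v : ℝ) (hv : v ∈ Icc (0 : ℝ) 1) :
      partialCumulative P (u, v) = partialCumulative P (0, v) :=
    eq_left_of_hasDerivAt_zero (f := fun x => partialCumulative P (x, v)) (by fun_prop)
      (fun u hu => hE u hu v hv) hu
  have h1 (u : ℝ) (hu : u ∈ Icc (0 : ℝ) 1) (v : ℝ) (hv : v ∈ Icc (0 : ℝ) 1) :
      partialCumulative P (u, v) = v := by
    have h2 := hP.cumulative_left_one v
    rw [cumulative_apply, integral_zero_one_congr fun u hu => h0 u hu v hv] at h2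
    rw [h0 u hu v hv]
    simpa using h2
  have h2 (u : ℝ) (hu : u ∈ Icc (0 : ℝ) 1) (v : ℝ) (hv : v ∈ Icc (0 : ℝ) 1) :
      cumulative P (u, v) = u * v := by
    rw [cumulative_apply, intervalIntegral.integral_congr (g := fun _ => v) fun s hs => ?_]
    · simp
    · rw [uIcc_of_le hu.1] at hs
      exact h1 s ⟨hs.1, hs.2.trans hu.2⟩ v hv
  have h3 : squareIntegral (P * cumulative P) =
      squareIntegral (tensor (ContinuousMap.id ℝ) (ContinuousMap.id ℝ)) := by
    refine squareIntegral_congr fun u hu v hv => ?_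
    simp [h2 u hu v hv, eq_deriv_partialCumulative hv (h1 u hu) (hasDerivAt_id v)]
  rw [kendallTau_eq_four_mul_sub_one hP, h3, squareIntegral_tensor]
  simp
  norm_num

theorem integral_density_mul_cumulative {P : C(ℝ × ℝ, ℝ)} (hP : IsContinuousCopulaDensity P)
    {θ : ℝ} (hθ : θ ≠ 0)
    (hE : ∀ u ∈ Ioo (0 : ℝ) 1, ∀ v ∈ Icc (0 : ℝ) 1,
      HasDerivAt (fun x => partialCumulative P (x, v))
        (θ * (partialCumulative P (u, v) ^ 2 - partialCumulative P (u, v))) u)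
    {u : ℝ} (hu : u ∈ Ioc (0 : ℝ) 1) :
    ∫ v in (0 : ℝ)..1, P (u, v) * cumulative P (u, v) = u / (1 - Real.exp (-θ * u)) - 1 / θ := by
  have huI : u ∈ Icc (0 : ℝ) 1 := ⟨hu.1.le, hu.2⟩
  have hne : 1 - Real.exp (-θ * u) ≠ 0 := by
    rw [neg_mul]
    exact one_sub_exp_neg_ne_zero (mul_ne_zero hθ hu.1.ne')
  have h1 := one_sub_exp_neg_ne_zero hθ
  have hpos (v : ℝ) (hv : v ∈ Icc (0 : ℝ) 1) : frankExp θ u v ≠ 0 := by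
    rw [← (frank_cumulative hP hθ hE huI hv).1]
    exact (Real.exp_pos _).ne'
  have hcum (v : ℝ) (hv : v ∈ Icc (0 : ℝ) 1) :
      cumulative P (u, v) = -Real.log (frankExp θ u v) / θ := by
    rw [← (frank_cumulative hP hθ hE huI hv).1, Real.log_exp]
    field_simp
  have hanti (v : ℝ) (hv : v ∈ uIcc (0 : ℝ) 1) :
      HasDerivAt (fun v => (-Real.log (frankExp θ u v) / θ - 1 / θ) *
        (Real.exp (-θ * u) / frankExp θ u v) / (1 - Real.exp (-θ * u)))
        (P (u, v) * cumulative P (u, v)) v := by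
    rw [uIcc_of_le zero_le_one] at hv
    have hw := hasDerivAt_frankExp θ u v
    have hwne := hpos v hv
    refine ((((((hw.log hwne).neg.div_const θ).sub_const (1 / θ)).mul
      ((hasDerivAt_const v (Real.exp (-θ * u))).div hw hwne))).div_const
        (1 - Real.exp (-θ * u))).congr_deriv ?_
    rw [hcum v hv, density_eq hP hθ hE huI hv]
    simp only [Pi.div_apply, Pi.neg_apply]
    generalize frankExp θ u v = w at *
    generalize Real.exp (-θ * u) = a at *
    field_simp
    ring
  rw [intervalIntegral.integral_eq_sub_of_hasDerivAt hanti
    (Continuous.intervalIntegrable (by fun_prop) _ _)]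
  have e1 : frankExp θ u 1 = Real.exp (-θ * u) := by
    simp [frankExp, div_self h1]
  have e0 : frankExp θ u 0 = 1 := by simp [frankExp]
  rw [e1, e0, Real.log_exp, Real.log_one]
  have ha := (Real.exp_pos (-θ * u)).ne'
  clear hanti hpos hcum e0 e1
  generalize Real.exp (-θ * u) = a at hne ha ⊢
  field_simp
  ring

theorem kendallTau_eq_debye {P : C(ℝ × ℝ, ℝ)} (hP : IsContinuousCopulaDensity P)
    {θ : ℝ} (hθ : θ ≠ 0)
    (hE : ∀ u ∈ Ioo (0 : ℝ) 1, ∀ v ∈ Icc (0 : ℝ) 1,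
      HasDerivAt (fun x => partialCumulative P (x, v))
        (θ * (partialCumulative P (u, v) ^ 2 - partialCumulative P (u, v))) u) :
    kendallTau (fun u v => P (u, v)) =
      1 - (4 / θ) * (1 - (1 / θ) * ∫ t in (0 : ℝ)..θ, t / (Real.exp t - 1)) := by
  set J : ℝ → ℝ := fun u => ∫ v in (0 : ℝ)..1, P (u, v) * cumulative P (u, v) with hJ
  have hJc : Continuous J := continuous_intervalIntegral_right (P * cumulative P) 0 1
  have hcongr : ∫ u in (0 : ℝ)..1, θ * u / (Real.exp (θ * u) - 1) =
      ∫ u in (0 : ℝ)..1, (θ * J u - θ * u + 1) := by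
    refine intervalIntegral.integral_congr_Ioo_of_le zero_le_one fun u hu => ?_
    have hne : 1 - Real.exp (-θ * u) ≠ 0 := by
      rw [neg_mul]
      exact one_sub_exp_neg_ne_zero (mul_ne_zero hθ hu.1.ne')
    have hexp : Real.exp (-θ * u) = (Real.exp (θ * u))⁻¹ := by rw [neg_mul, Real.exp_neg]
    have hpos := (Real.exp_pos (θ * u)).ne'
    simp only [hJ, integral_density_mul_cumulative hP hθ hE (Ioo_subset_Ioc_self hu)]
    rw [hexp] at hne ⊢
    have hne' : Real.exp (θ * u) - 1 ≠ 0 := by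
      intro h
      apply hne
      rw [sub_eq_zero.1 h]; simp
    field_simp
    ring
  have hsub : ∫ t in (0 : ℝ)..θ, t / (Real.exp t - 1) =
      θ * ∫ u in (0 : ℝ)..1, θ * u / (Real.exp (θ * u) - 1) := by
    have := intervalIntegral.mul_integral_comp_mul_left (a := 0) (b := 1)
      (f := fun t : ℝ => t / (Real.exp t - 1)) θ
    simpa using this.symm
  have hint : ∫ u in (0 : ℝ)..1, (θ * J u - θ * u + 1) =
      θ * squareIntegral (P * cumulative P) - θ / 2 + 1 := by
    rw [intervalIntegral.integral_add (Continuous.intervalIntegrable (by fun_prop) _ _) (by simp),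
      intervalIntegral.integral_sub (Continuous.intervalIntegrable (by fun_prop) _ _)
        (Continuous.intervalIntegrable (by fun_prop) _ _), intervalIntegral.integral_const_mul,
      intervalIntegral.integral_const_mul, squareIntegral_apply]
    simp [hJ]
    ring
  rw [kendallTau_eq_four_mul_sub_one hP, hsub, hcongr, hint]
  field_simp
  ring

/-- The MICK with fixed Kendall's `τ ≠ 0` is the Frank copula density with parameter `θ`
determined by the Debye-function relation `τ = 1 − (4/θ)[1 − (1/θ)∫₀^θ t/(eᵗ−1) dt]`. -/
theorem mick_eq_frank_debye (τ : ℝ) (hτ : τ ∈ Set.Ioo (-1 : ℝ) 1) (hτ0 : τ ≠ 0)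
    (p : ℝ → ℝ → ℝ) (hp : IsCopulaDensity p) (hK : kendallTau p = τ)
    (hmin : ∀ q : ℝ → ℝ → ℝ, IsCopulaDensity q → kendallTau q = τ →
      shannonInfo p ≤ shannonInfo q) :
    ∃ θ : ℝ, θ ≠ 0 ∧
      τ = 1 - (4 / θ) * (1 - (1 / θ) * ∫ t in (0 : ℝ)..θ, t / (Real.exp t - 1)) ∧
      (∀ u ∈ Set.Icc (0 : ℝ) 1, ∀ v ∈ Set.Icc (0 : ℝ) 1, p u v = frankDensity θ u v) := by
  obtain ⟨P, hP, hPp⟩ := hp.exists_extension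
  obtain ⟨c, hc⟩ := exists_log_eq_of_isMin hp (fun q hq hKq => hmin q hq (hKq.trans hK)) hP hPp
  have hKP : kendallTau (fun u v => P (u, v)) = τ := by
    rw [← hK]
    refine integral_zero_one_congr fun u hu => integral_zero_one_congr fun v hv =>
      integral_zero_one_congr fun s hs => integral_zero_one_congr fun t ht => ?_
    simp only [hPp u hu v hv, hPp s hs t ht]
  have hE (u : ℝ) (hu : u ∈ Ioo (0 : ℝ) 1) (v : ℝ) (hv : v ∈ Icc (0 : ℝ) 1) :=
    hasDerivAt_partialCumulative_logistic hP (θ := c / 2)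
      (fun u hu v hv => by rw [hc u hu v hv]; ring) (hp.contDiffOn_log hPp) hu hv
  have hθ : c / 2 ≠ 0 := by
    intro h0
    simp only [h0, zero_mul] at hE
    exact hτ0 (hKP ▸ kendallTau_eq_zero_of_hasDerivAt_zero hP hE)
  refine ⟨c / 2, hθ, ?_, fun u hu v hv => ?_⟩
  · rw [← hKP]
    exact kendallTau_eq_debye hP hθ hE
  · rw [← hPp u hu v hv]
    exact density_eq_frankDensity hP hθ hE hu hv
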